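/- Let p be a prime number with p ≡ 2 (mod 3), and let g be the matrix [[1,−3],[1,−2]] viewed in GL₂(ℤ/p²ℤ). Then g has order 3 in GL₂(ℤ/p²ℤ), g does not belong to H₂, and the quotient group G₂/H₂ is cyclic of order 3, generated by the class of g. -/

import Mathlib

/-- The matrix `h(a,b)` over `ℤ/p²ℤ`. -/
def hmat (p : ℕ) (a b : ZMod (p ^ 2)) : Matrix (Fin 2) (Fin 2) (ZMod (p ^ 2)) :=
  !![1 + (p : ZMod (p ^ 2)) * (a - 2 * b), 3 * (p : ZMod (p ^ 2)) * (b - a);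
     -((p : ZMod (p ^ 2)) * b), 1 - (p : ZMod (p ^ 2)) * (a - 2 * b)]

/-- `H₂ = {h(a,b) : a, b ∈ ℤ/p²ℤ}`, seen inside `GL₂(ℤ/p²ℤ)`. -/
def H2set (p : ℕ) : Set ((Matrix (Fin 2) (Fin 2) (ZMod (p ^ 2)))ˣ) :=
  {u | ∃ a b : ZMod (p ^ 2), (u : Matrix (Fin 2) (Fin 2) (ZMod (p ^ 2))) = hmat p a b}

/-- `H₂` as a subgroup of `GL₂(ℤ/p²ℤ)` (it is a subgroup, so it coincides with
the subgroup it generates). -/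
def H2sub (p : ℕ) : Subgroup ((Matrix (Fin 2) (Fin 2) (ZMod (p ^ 2)))ˣ) :=
  Subgroup.closure (H2set p)

/-- `G₂`, the subgroup of `GL₂(ℤ/p²ℤ)` generated by `g` and `H₂`. -/
def G2 (p : ℕ) (g : (Matrix (Fin 2) (Fin 2) (ZMod (p ^ 2)))ˣ) :
    Subgroup ((Matrix (Fin 2) (Fin 2) (ZMod (p ^ 2)))ˣ) :=
  Subgroup.closure ({g} ∪ H2set p)

/-- The units of a ring congruent to `1` up to the annihilator of a scalar `c`. -/
def smulFixingUnits {R A : Type*} [CommRing R] [Ring A] [Algebra R A] (c : R) : Subgroup Aˣ where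
  carrier := {u | c • (u : A) = c • (1 : A)}
  one_mem' := by simp
  mul_mem' := by
    intro u v hu hv
    simp only [Set.mem_ofPred_eq, Units.val_mul] at *
    rw [← smul_mul_assoc, hu, smul_mul_assoc, one_mul, hv]
  inv_mem' := by
    intro u hu
    simp only [Set.mem_ofPred_eq] at *
    rw [← one_mul ((u⁻¹ : Aˣ) : A), ← smul_mul_assoc, ← hu, smul_mul_assoc,
      Units.mul_inv, hu]

theorem natCast_mul_natCast_self (p : ℕ) : (p : ZMod (p ^ 2)) * p = 0 := by
  rw [← Nat.cast_mul, ← sq, ZMod.natCast_self]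

theorem natCast_ne_zero_zmod_sq {p : ℕ} (hp : p.Prime) : (p : ZMod (p ^ 2)) ≠ 0 := by
  rw [Ne, ZMod.natCast_eq_zero_iff]
  intro h
  have := Nat.le_of_dvd hp.pos h
  nlinarith [hp.two_le]

theorem natCast_smul_hmat (p : ℕ) (a b : ZMod (p ^ 2)) :
    (p : ZMod (p ^ 2)) • hmat p a b =
      (p : ZMod (p ^ 2)) • (1 : Matrix (Fin 2) (Fin 2) (ZMod (p ^ 2))) := by
  have h := natCast_mul_natCast_self p
  ext i j
  fin_cases i <;> fin_cases j <;> simp [hmat]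
  · linear_combination (a - 2 * b) * h
  · linear_combination 3 * (b - a) * h
  · linear_combination b * h
  · linear_combination -(a - 2 * b) * h

theorem H2sub_le_smulFixingUnits (p : ℕ) :
    H2sub p ≤ smulFixingUnits (p : ZMod (p ^ 2)) := by
  refine (Subgroup.closure_le _).2 ?_
  rintro u ⟨a, b, hu⟩
  change (p : ZMod (p ^ 2)) • (u : Matrix (Fin 2) (Fin 2) (ZMod (p ^ 2))) = _
  rw [hu, natCast_smul_hmat]

/-- **(part of Lemma 3.2, following [GR18, Section 5]).**
`g = [[1,−3],[1,−2]]` has order `3` in `GL₂(ℤ/p²ℤ)`, does not belong to `H₂`,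
and the quotient `G₂/H₂` is cyclic of order `3`, generated by the class of `g`. -/
theorem G2_quotient_H2_cyclic_of_order_three (p : ℕ) [Fact p.Prime] (hp3 : p % 3 = 2)
    (g : (Matrix (Fin 2) (Fin 2) (ZMod (p ^ 2)))ˣ)
    (hg : (g : Matrix (Fin 2) (Fin 2) (ZMod (p ^ 2))) = !![1, -3; 1, -2])
    (hnorm : ((H2sub p).subgroupOf (G2 p g)).Normal) :
    orderOf g = 3 ∧
    g ∉ H2sub p ∧
    Nat.card ((G2 p g) ⧸ (H2sub p).subgroupOf (G2 p g)) = 3 ∧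
    ∀ q : (G2 p g) ⧸ (H2sub p).subgroupOf (G2 p g), ∃ n : ℤ,
      q = QuotientGroup.mk
        ((⟨g, Subgroup.subset_closure (Set.mem_union_left _ rfl)⟩ : G2 p g) ^ n) := by
  have hgN : g ∉ H2sub p := by
    intro h
    have h1 : (p : ZMod (p ^ 2)) • (g : Matrix (Fin 2) (Fin 2) (ZMod (p ^ 2))) =
        (p : ZMod (p ^ 2)) • 1 := H2sub_le_smulFixingUnits p h
    rw [hg] at h1
    have h2 := congrFun (congrFun h1 1) 0
    simp at h2
    exact natCast_ne_zero_zmod_sq Fact.out h2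
  have hg3 : g ^ 3 = 1 := by
    ext1
    rw [Units.val_pow_eq_pow_val, hg, pow_three, Units.val_one]
    ext i j
    fin_cases i <;> fin_cases j <;> simp [Matrix.mul_apply, Fin.sum_univ_two] <;> ring
  have hg1 : g ≠ 1 := fun h => hgN (h ▸ one_mem _)
  have : Fact (Nat.Prime 3) := ⟨Nat.prime_three⟩
  set N := (H2sub p).subgroupOf (G2 p g)
  set γ : G2 p g := ⟨g, Subgroup.subset_closure (Set.mem_union_left _ rfl)⟩
  have hcyc (q : G2 p g ⧸ N) : q ∈ Subgroup.zpowers (γ : G2 p g ⧸ N) := by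
    have hle : G2 p g ≤ ((Subgroup.zpowers (γ : G2 p g ⧸ N)).comap
        (QuotientGroup.mk' N)).map (G2 p g).subtype := by
      refine (Subgroup.closure_le _).2 ?_
      rintro u (rfl | hu)
      · exact ⟨γ, Subgroup.mem_zpowers _, rfl⟩
      · have huG : u ∈ G2 p g := Subgroup.subset_closure (Set.mem_union_right _ hu)
        refine ⟨⟨u, huG⟩, ?_, rfl⟩
        have huN : QuotientGroup.mk' N ⟨u, huG⟩ = 1 :=
          (QuotientGroup.eq_one_iff _).2 (Subgroup.subset_closure hu)
        change QuotientGroup.mk' N ⟨u, huG⟩ ∈ Subgroup.zpowers (γ : G2 p g ⧸ N)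
        rw [huN]
        exact one_mem _
    obtain ⟨x, rfl⟩ := QuotientGroup.mk_surjective q
    obtain ⟨y, hy, hyx⟩ := hle x.2
    obtain rfl : y = x := Subtype.ext hyx
    exact hy
  refine ⟨orderOf_eq_prime hg3 hg1, hgN, ?_, fun q => ?_⟩
  · rw [← orderOf_eq_card_of_forall_mem_zpowers hcyc]
    refine orderOf_eq_prime ?_ fun h => hgN ((QuotientGroup.eq_one_iff γ).1 h)
    rw [← QuotientGroup.mk_pow, show γ ^ 3 = 1 from Subtype.ext hg3, QuotientGroup.mk_one]
  · obtain ⟨n, hn⟩ := hcyc q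
    exact ⟨n, hn.symm⟩
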